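/- arXiv:cond-mat/0204100 — 4 statements merged into one kernel-verified Lean document; each statement's English description precedes it below -/
import Mathlib

section
/- For the one-dimensional random trap model, i.e. when w₊(n) = w₋(n) = w(n) > 0 for every site n (the jump rate depends only on the departure site), any solution T of the backward-equation characterization satisfies T(0) = Σ_{k=0}^{N−1} (N−k)/w(k). Thus the mean first-passage time of the random trap model on a chain of length N is t̄₁ = N/w(0) + (N−1)/w(1) + ⋯ + 1/w(N−1). -/
/-- Increments of the mean first-passage time in the random trap model. -/
lemma trap_increment (N : ℕ) (w T : ℕ → ℝ)
    (hw : ∀ n, n ≤ N - 1 → 0 < w n)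
    (hT0 : w 0 * (T 0 - T 1) = 1)
    (hTn : ∀ n, 1 ≤ n → n ≤ N - 1 →
      (w n + w n) * T n - w n * T (n + 1) - w n * T (n - 1) = 1)
    (n : ℕ) (hn : n ≤ N - 1) :
    T n - T (n + 1) = ∑ k ∈ Finset.range (n + 1), 1 / w k := by
  induction n with
  | zero =>
    rw [Finset.sum_range_one, eq_div_iff (hw 0 hn).ne', mul_comm]
    exact hT0
  | succ n ih =>
    have h := hTn (n + 1) (by omega) hn
    rw [Nat.add_sub_cancel] at h
    rw [Finset.sum_range_succ, ← ih (by omega), ← sub_eq_iff_eq_add',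
      eq_div_iff (hw (n + 1) hn).ne']
    linarith

/-- Raising every weight by one adds one more partial sum. -/
lemma sum_range_succ_sub_div (f : ℕ → ℝ) (m : ℕ) :
    ∑ k ∈ Finset.range (m + 1), ((m + 1 - k : ℕ) : ℝ) / f k =
      ∑ k ∈ Finset.range m, ((m - k : ℕ) : ℝ) / f k +
        ∑ k ∈ Finset.range (m + 1), 1 / f k := by
  rw [Finset.sum_range_succ, Finset.sum_range_succ (fun k => 1 / f k), ← add_assoc,
    ← Finset.sum_add_distrib]
  congr 1
  · refine Finset.sum_congr rfl fun k hk => ?_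
    rw [Nat.sub_add_comm (Finset.mem_range.1 hk).le, Nat.cast_add_one, add_div]
  · simp

/-- For the one-dimensional random trap model (`w₊(n) = w₋(n) = w(n)`), the mean
first-passage time from site `0` to site `N` characterized by the backward equations
is `t̄₁ = Σ_{k=0}^{N−1} (N−k)/w(k)`. -/
theorem stmt4 (N : ℕ) (hN : 1 ≤ N) (w : ℕ → ℝ)
    (hw : ∀ n, n ≤ N - 1 → 0 < w n)
    (T : ℕ → ℝ)
    (hTN : T N = 0)
    (hT0 : w 0 * (T 0 - T 1) = 1)
    (hTn : ∀ n, 1 ≤ n → n ≤ N - 1 →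
      (w n + w n) * T n - w n * T (n + 1) - w n * T (n - 1) = 1) :
    T 0 = ∑ k ∈ Finset.range N, ((N - k : ℕ) : ℝ) / w k := by
  have key : ∀ m ≤ N, T 0 - T m = ∑ k ∈ Finset.range m, ((m - k : ℕ) : ℝ) / w k := by
    intro m hm
    induction m with
    | zero => simp
    | succ m ih =>
      rw [sum_range_succ_sub_div, ← ih (by omega),
        ← trap_increment N w T hw hT0 hTn m (by omega)]
      ring
  rw [← key N le_rfl, hTN, sub_zero]
end

section
/- For every n ≥ 2 and every ω with 0 < ω ≤ ω_n, the following four inequalities hold: Im f_n(ω) > 0; Re f_{n−1}(ω) > 0; Im f_n(ω) > Im f_{n−1}(ω); and Re f_n(ω) < Re f_{n−1}(ω). Consequently ω_n ≤ ω_{n−1}, and Re f_n(ω) < Re f_{n−1}(ω) < ⋯ < Re f_1(ω) = 1 for all ω ∈ (0, ω_n]. -/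
/-- A continuous real function that is positive at `0` and nonpositive at `t > 0` has a first
zero in `(0, t]`. -/
theorem exists_first_zero {g : ℝ → ℝ} (hg : Continuous g) (h0 : 0 < g 0) {t : ℝ} (ht : 0 < t)
    (hgt : g t ≤ 0) :
    ∃ s, 0 < s ∧ s ≤ t ∧ g s = 0 ∧ ∀ r, 0 < r → g r = 0 → s ≤ r := by
  have hcomp : IsCompact (Set.Icc 0 t ∩ g ⁻¹' {0}) :=
    isCompact_Icc.inter_right (isClosed_singleton.preimage hg)
  have hne : (Set.Icc 0 t ∩ g ⁻¹' {0}).Nonempty := by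
    obtain ⟨s, hs, hs0⟩ := intermediate_value_Icc' ht.le hg.continuousOn ⟨hgt, h0.le⟩
    exact ⟨s, hs, hs0⟩
  obtain ⟨s, ⟨⟨hs0, hst⟩, hgs⟩, hmin⟩ := hcomp.exists_isLeast hne
  have hgs : g s = 0 := hgs
  refine ⟨s, hs0.lt_of_ne ?_, hst, hgs, fun r hr hgr => ?_⟩
  · rintro rfl
    exact h0.ne' hgs
  · by_contra! hrs
    exact hrs.not_ge (hmin ⟨⟨hr.le, hrs.le.trans hst⟩, hgr⟩)

/-- The real and imaginary parts `x`, `y` of the inverse admittances, characterised by the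
recursion for their increments. -/
structure IsAdmittancePair (a b : ℕ → ℝ) (x y : ℕ → ℝ → ℝ) : Prop where
  a_pos : ∀ n, 1 ≤ n → 0 < a n
  b_pos : ∀ n, 2 ≤ n → 0 < b n
  re_zero : ∀ ω, x 0 ω = 1
  im_zero : ∀ ω, y 0 ω = 0
  re_one : ∀ ω, x 1 ω = 1
  im_one : ∀ ω, y 1 ω = ω / a 1
  re_step : ∀ n ω, x (n + 2) ω = x (n + 1) ω - ω / a (n + 2) * y (n + 1) ω +
    b (n + 2) / a (n + 2) * (x (n + 1) ω - x n ω)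
  im_step : ∀ n ω, y (n + 2) ω = y (n + 1) ω + ω / a (n + 2) * x (n + 1) ω +
    b (n + 2) / a (n + 2) * (y (n + 1) ω - y n ω)

namespace IsAdmittancePair

variable {a b : ℕ → ℝ} {x y : ℕ → ℝ → ℝ}

theorem continuous (h : IsAdmittancePair a b x y) (n : ℕ) :
    Continuous (x n) ∧ Continuous (y n) := by
  induction n using Nat.twoStepInduction with
  | zero => exact ⟨by simp only [funext h.re_zero, continuous_const],
      by simp only [funext h.im_zero, continuous_const]⟩
  | one =>
    rw [funext h.re_one, funext h.im_one]
    exact ⟨by fun_prop, by fun_prop⟩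
  | more n ih₀ ih₁ =>
    obtain ⟨hx₀, hy₀⟩ := ih₀
    obtain ⟨hx₁, hy₁⟩ := ih₁
    rw [funext (h.re_step n), funext (h.im_step n)]
    exact ⟨by fun_prop, by fun_prop⟩

theorem re_apply_zero (h : IsAdmittancePair a b x y) (n : ℕ) : x n 0 = 1 := by
  induction n using Nat.twoStepInduction with
  | zero => exact h.re_zero 0
  | one => exact h.re_one 0
  | more n ih₀ ih₁ => rw [h.re_step, ih₀, ih₁]; ring

theorem monotonicity (h : IsAdmittancePair a b x y) {ω : ℝ} (hω : 0 < ω) (n : ℕ)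
    (hx : ∀ k ≤ n, 0 ≤ x k ω) :
    0 < y (n + 1) ω ∧ y n ω < y (n + 1) ω ∧ x (n + 1) ω ≤ x n ω ∧
      (1 ≤ n → x (n + 1) ω < x n ω) := by
  induction n with
  | zero =>
    have := div_pos hω (h.a_pos 1 le_rfl)
    simp [h.im_one, h.im_zero, h.re_one, h.re_zero, this]
  | succ n ih =>
    obtain ⟨hy, hlt, hle, -⟩ := ih fun k hk => hx k (by omega)
    have ha := h.a_pos (n + 2) (by omega)
    have hc := div_pos hω ha
    have hd := div_pos (h.b_pos (n + 2) (by omega)) ha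
    have him := mul_nonneg hc.le (hx (n + 1) le_rfl)
    have hdim := mul_pos hd (sub_pos.2 hlt)
    have hre := mul_pos hc hy
    have hdre := mul_nonneg hd.le (sub_nonneg.2 hle)
    have hxs := h.re_step n ω
    have hys := h.im_step n ω
    have hxlt : x (n + 2) ω < x (n + 1) ω := by linarith
    exact ⟨by linarith, by linarith, hxlt.le, fun _ => hxlt⟩

theorem re_pos_of_le_first_zero (h : IsAdmittancePair a b x y) (n : ℕ) {ω : ℝ} (hω : 0 < ω)
    (hmin : ∀ ω', 0 < ω' → x (n + 1) ω' = 0 → ω ≤ ω') : ∀ k ≤ n, 0 < x k ω := by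
  induction n generalizing ω with
  | zero =>
    intro k hk
    obtain rfl : k = 0 := by omega
    simp [h.re_zero]
  | succ n ih =>
    have hpos : ∀ t, 0 < t → t ≤ ω → 0 < x (n + 1) t := by
      intro t ht htω
      by_contra! hneg
      obtain ⟨s, hs, hst, hxs, hsmin⟩ := exists_first_zero (h.continuous (n + 1)).1
        (by simp [h.re_apply_zero]) ht hneg
      have hlt : x (n + 2) s < 0 := by
        rw [← hxs]
        refine (h.monotonicity hs (n + 1) fun k hk => ?_).2.2.2 (by omega)
        rcases hk.eq_or_lt with rfl | hk
        · exact hxs.ge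
        · exact (ih hs hsmin k (by omega)).le
      obtain ⟨r, hr, hrs, hxr, -⟩ := exists_first_zero (h.continuous (n + 2)).1
        (by simp [h.re_apply_zero]) hs hlt.le
      obtain rfl : r = s := le_antisymm hrs ((hst.trans htω).trans (hmin r hr hxr))
      exact hlt.ne hxr
    intro k hk
    rcases hk.eq_or_lt with rfl | hk
    · exact hpos ω hω le_rfl
    · refine ih hω (fun t ht hxt => ?_) k (by omega)
      by_contra! htω
      exact (hpos t ht htω.le).ne' hxt

end IsAdmittancePair

/-- For the inverse admittances `f_n = χ_n⁻¹` of a disordered chain, defined by the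
recursion of Eq. (23), and for every `n ≥ 2` and `0 < ω ≤ ω_n` (where `ω_n` is the
smallest positive zero of `Re f_n`, i.e. no positive zero of `Re f_n` lies below `ω`):
`Im f_n(ω) > 0`, `Re f_{n−1}(ω) > 0`, `Im f_n(ω) > Im f_{n−1}(ω)`,
`Re f_n(ω) < Re f_{n−1}(ω)`; consequently `ω_n ≤ ω_{n−1}` (i.e. `ω ≤ ω_{n−1}` as well)
and `Re f_n(ω) < Re f_{n−1}(ω) < ⋯ < Re f_1(ω) = 1`. -/
theorem stmt6 (a b : ℕ → ℝ)
    (ha : ∀ n, 1 ≤ n → 0 < a n) (hb : ∀ n, 2 ≤ n → 0 < b n)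
    (f : ℕ → ℝ → ℂ)
    (hf0 : ∀ ω : ℝ, f 0 ω = 1)
    (hf1 : ∀ ω : ℝ, f 1 ω = 1 + Complex.I * ω / a 1)
    (hfrec : ∀ n, 2 ≤ n → ∀ ω : ℝ,
      f n ω = (Complex.I * ω / a n + 1 + b n / a n) * f (n - 1) ω -
        (b n / a n : ℝ) * f (n - 2) ω)
    (n : ℕ) (hn : 2 ≤ n) (ω : ℝ) (hω : 0 < ω)
    (hωn : ∀ ω' : ℝ, 0 < ω' → (f n ω').re = 0 → ω ≤ ω') :
    0 < (f n ω).im ∧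
    0 < (f (n - 1) ω).re ∧
    (f (n - 1) ω).im < (f n ω).im ∧
    (f n ω).re < (f (n - 1) ω).re ∧
    (∀ ω' : ℝ, 0 < ω' → (f (n - 1) ω').re = 0 → ω ≤ ω') ∧
    (∀ k, 2 ≤ k → k ≤ n → (f k ω).re < (f (k - 1) ω).re) ∧
    (f 1 ω).re = 1 := by
  have h : IsAdmittancePair a b (fun n ω => (f n ω).re) (fun n ω => (f n ω).im) := by
    have hf1' (ω : ℝ) : f 1 ω = 1 + ((ω / a 1 : ℝ) : ℂ) * Complex.I := by
      rw [hf1]; push_cast; ring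
    have hstep (n : ℕ) (ω : ℝ) : f (n + 2) ω = f (n + 1) ω +
        ((ω / a (n + 2) : ℝ) : ℂ) * (Complex.I * f (n + 1) ω) +
        ((b (n + 2) / a (n + 2) : ℝ) : ℂ) * (f (n + 1) ω - f n ω) := by
      rw [hfrec (n + 2) (by omega)]
      simp only [Nat.add_sub_cancel, show n + 2 - 1 = n + 1 by omega]
      push_cast
      ring
    refine ⟨ha, hb, ?_, ?_, ?_, ?_, ?_, ?_⟩
    · simp [hf0]
    · simp [hf0]
    · intro ω
      simp only [hf1', Complex.add_re, Complex.re_ofReal_mul, Complex.I_re, Complex.one_re]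
      ring
    · intro ω
      simp only [hf1', Complex.add_im, Complex.im_ofReal_mul, Complex.I_im, Complex.one_im]
      ring
    · intro n ω
      simp only [hstep n, Complex.add_re, Complex.re_ofReal_mul, Complex.I_mul_re, Complex.sub_re]
      ring
    · intro n ω
      simp only [hstep n, Complex.add_im, Complex.im_ofReal_mul, Complex.I_mul_im, Complex.sub_im]
  obtain ⟨m, rfl⟩ := Nat.exists_eq_add_of_le' (show 1 ≤ n by omega)
  simp only [Nat.add_sub_cancel]
  have hpos := h.re_pos_of_le_first_zero m hω hωn
  obtain ⟨hy, hlt, -, hxlt⟩ := h.monotonicity hω m fun k hk => (hpos k hk).le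
  refine ⟨hy, hpos m le_rfl, hlt, hxlt (by omega), fun t ht hxt => ?_, fun k hk hkm => ?_,
    h.re_one ω⟩
  · by_contra! htω
    exact (h.re_pos_of_le_first_zero m ht (fun s hs hxs => htω.le.trans (hωn s hs hxs))
      m le_rfl).ne' hxt
  · obtain ⟨j, rfl⟩ := Nat.exists_eq_add_of_le' (show 1 ≤ k by omega)
    exact (h.monotonicity hω j fun i hi => (hpos i (by omega)).le).2.2.2 (by omega)
end

section
/- For every n ≥ 2 and every ω with 0 < ω ≤ ω_n, one has f_n(ω) ≠ 0, Re f_n(ω) < 1, and the admittance χ_n(ω) := 1/f_n(ω) satisfies (Re χ_n(ω) − 1/2)² + (Im χ_n(ω))² > 1/4. That is, for frequencies smaller than the smallest positive zero of the real part of the inverse admittance, the Cole-Cole plot of the admittance of any sample of the disordered chain lies strictly outside the Debye semicircle of center (1/2, 0) and radius 1/2. -/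
/-- A continuous function positive on `(0, z)` is nonnegative at `z`. -/
theorem nonneg_right_endpoint_of_pos {h : ℝ → ℝ} (hc : Continuous h) {z : ℝ} (hz : 0 < z)
    (hpos : ∀ t, 0 < t → t < z → 0 < h t) : 0 ≤ h z := by
  have hmem : z ∈ closure (Set.Ioo 0 z) := by
    rw [closure_Ioo hz.ne]
    exact Set.right_mem_Icc.2 hz.le
  exact closure_minimal (fun t ht => (hpos t ht.1 ht.2).le)
    (isClosed_le continuous_const hc) hmem

/-- A continuous function positive at `0` and nonpositive at `w > 0` has a first zero
in `(0, w]`. -/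
theorem exists_first_pos_zero {h : ℝ → ℝ} (hc : Continuous h) (h0 : 0 < h 0) {w : ℝ}
    (hw : 0 < w) (hle : h w ≤ 0) :
    ∃ z, 0 < z ∧ z ≤ w ∧ h z = 0 ∧ ∀ t, 0 < t → t < z → 0 < h t := by
  have hcomp : IsCompact (Set.Icc 0 w ∩ {t | h t ≤ 0}) :=
    isCompact_Icc.inter_right (isClosed_le hc continuous_const)
  obtain ⟨z, ⟨⟨hz0, hzw⟩, hz⟩, hmin⟩ := hcomp.exists_isLeast ⟨w, ⟨hw.le, le_rfl⟩, hle⟩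
  have hzpos : 0 < z := by
    refine lt_of_le_of_ne hz0 ?_
    rintro rfl
    exact absurd hz (not_le.2 h0)
  have hpos : ∀ t, 0 < t → t < z → 0 < h t := fun t ht htz => by
    by_contra! hcon
    exact absurd (hmin ⟨⟨ht.le, htz.le.trans hzw⟩, hcon⟩) (not_le.2 htz)
  exact ⟨z, hzpos, hzw, le_antisymm hz (nonneg_right_endpoint_of_pos hc hzpos hpos), hpos⟩

/-- For real and imaginary parts `x`, `y` of the inverse admittances at a fixed frequency `ω`:
as long as the real parts are nonnegative, the imaginary parts increase and the real parts
decrease. -/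
theorem chain_monotone {a b x y : ℕ → ℝ} {ω : ℝ} (hω : 0 < ω)
    (ha : ∀ n, 1 ≤ n → 0 < a n) (hb : ∀ n, 2 ≤ n → 0 < b n)
    (hx0 : x 0 = 1) (hy0 : y 0 = 0) (hx1 : x 1 = 1) (hy1 : a 1 * y 1 = ω)
    (hx : ∀ n, a (n + 2) * (x (n + 2) - x (n + 1)) =
      -(ω * y (n + 1)) + b (n + 2) * (x (n + 1) - x n))
    (hy : ∀ n, a (n + 2) * (y (n + 2) - y (n + 1)) =
      ω * x (n + 1) + b (n + 2) * (y (n + 1) - y n))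
    (n : ℕ) (hre : ∀ j ≤ n, 0 ≤ x j) :
    0 < y (n + 1) ∧ y n < y (n + 1) ∧ x (n + 1) ≤ x n ∧ x (n + 1) ≤ 1 ∧
      (1 ≤ n → x (n + 1) < x n ∧ x (n + 1) < 1) := by
  induction n with
  | zero =>
    have hpos : 0 < y 1 := pos_of_mul_pos_right (hy1 ▸ hω) (ha 1 le_rfl).le
    simp [hx0, hy0, hx1, hpos]
  | succ n ih =>
    obtain ⟨hypos, hymono, hxanti, hxle, -⟩ := ih fun j hj => hre j (hj.trans n.le_succ)
    have hapos := ha (n + 2) (by omega)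
    have hbpos := hb (n + 2) (by omega)
    have hdy : 0 < y (n + 2) - y (n + 1) := by
      refine pos_of_mul_pos_right ?_ hapos.le
      rw [hy]
      have := mul_nonneg hω.le (hre (n + 1) le_rfl)
      have := mul_pos hbpos (sub_pos.2 hymono)
      linarith
    have hdx : x (n + 2) - x (n + 1) < 0 := by
      refine neg_of_mul_neg_right ?_ hapos.le
      rw [hx]
      have := mul_pos hω hypos
      have := mul_nonneg hbpos.le (sub_nonneg.2 hxanti)
      linarith
    refine ⟨?_, ?_, ?_, ?_, fun _ => ⟨?_, ?_⟩⟩ <;> linarith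

/-- A complex number with real part less than `1` is mapped by inversion strictly outside the
Debye semicircle. -/
theorem outside_debye_of_re_lt_one {z : ℂ} (hz : z ≠ 0) (hre : z.re < 1) :
    (1 / 4 : ℝ) < ((1 / z).re - 1 / 2) ^ 2 + ((1 / z).im) ^ 2 := by
  have hN : 0 < Complex.normSq z := Complex.normSq_pos.2 hz
  have key : ((1 / z).re - 1 / 2) ^ 2 + ((1 / z).im) ^ 2 =
      1 / 4 + (1 - z.re) / Complex.normSq z := by
    rw [one_div, Complex.inv_re, Complex.inv_im]
    have hsq : z.im ^ 2 = Complex.normSq z - z.re ^ 2 := by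
      rw [Complex.normSq_apply]; ring
    field_simp
    rw [hsq]
    ring
  rw [key]
  have := div_pos (sub_pos.2 hre) hN
  linarith


/-- For the inverse admittances `f_n = χ_n⁻¹` of a disordered chain, defined by the
recursion of Eq. (23), for every `n ≥ 2` and every `ω` with `0 < ω ≤ ω_n` (no positive
zero of `Re f_n` lies below `ω`), one has `f_n(ω) ≠ 0`, `Re f_n(ω) < 1`, and the
admittance `χ_n(ω) = 1/f_n(ω)` lies strictly outside the Debye semicircle:
`(Re χ_n(ω) − 1/2)² + (Im χ_n(ω))² > 1/4`. -/
theorem stmt7 (a b : ℕ → ℝ)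
    (ha : ∀ n, 1 ≤ n → 0 < a n) (hb : ∀ n, 2 ≤ n → 0 < b n)
    (f : ℕ → ℝ → ℂ)
    (hf0 : ∀ ω : ℝ, f 0 ω = 1)
    (hf1 : ∀ ω : ℝ, f 1 ω = 1 + Complex.I * ω / a 1)
    (hfrec : ∀ n, 2 ≤ n → ∀ ω : ℝ,
      f n ω = (Complex.I * ω / a n + 1 + b n / a n) * f (n - 1) ω -
        (b n / a n : ℝ) * f (n - 2) ω)
    (n : ℕ) (hn : 2 ≤ n) (ω : ℝ) (hω : 0 < ω)
    (hωn : ∀ ω' : ℝ, 0 < ω' → (f n ω').re = 0 → ω ≤ ω') :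
    f n ω ≠ 0 ∧
    (f n ω).re < 1 ∧
    (1 / 4 : ℝ) < ((1 / f n ω).re - 1 / 2) ^ 2 + ((1 / f n ω).im) ^ 2 := by
  have hxrec : ∀ ω : ℝ, ∀ n, a (n + 2) * ((f (n + 2) ω).re - (f (n + 1) ω).re) =
      -(ω * (f (n + 1) ω).im) + b (n + 2) * ((f (n + 1) ω).re - (f n ω).re) := by
    intro ω n
    have hane := (ha (n + 2) (by omega)).ne'
    have h := congrArg Complex.re (hfrec (n + 2) (by omega) ω)
    simp [← Complex.ofReal_div, mul_div_assoc] at h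
    rw [h]
    field_simp
    ring
  have hyrec : ∀ ω : ℝ, ∀ n, a (n + 2) * ((f (n + 2) ω).im - (f (n + 1) ω).im) =
      ω * (f (n + 1) ω).re + b (n + 2) * ((f (n + 1) ω).im - (f n ω).im) := by
    intro ω n
    have hane := (ha (n + 2) (by omega)).ne'
    have h := congrArg Complex.im (hfrec (n + 2) (by omega) ω)
    simp [← Complex.ofReal_div, mul_div_assoc] at h
    rw [h]
    field_simp
    ring
  have hx1 : ∀ ω, (f 1 ω).re = 1 := fun ω => by
    rw [hf1]; simp [← Complex.ofReal_div, mul_div_assoc]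
  have hy1 : ∀ ω, a 1 * (f 1 ω).im = ω := fun ω => by
    have := (ha 1 le_rfl).ne'
    rw [hf1]; simp [← Complex.ofReal_div, mul_div_assoc]; field_simp
  have hmono := fun (ω : ℝ) (hω : 0 < ω) => chain_monotone (x := fun n => (f n ω).re)
    (y := fun n => (f n ω).im) hω ha hb (by simp [hf0]) (by simp [hf0]) (hx1 ω) (hy1 ω)
    (hxrec ω) (hyrec ω)
  have hcont : ∀ n, Continuous (f n) := by
    intro n
    induction n using Nat.twoStepInduction with
    | zero => rw [funext hf0]; fun_prop
    | one => rw [funext hf1]; fun_prop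
    | more n h0 h1 =>
      rw [funext (hfrec (n + 2) (by omega))]
      simp only [Nat.add_sub_cancel, show n + 2 - 1 = n + 1 from rfl]
      fun_prop
  have hcre : ∀ n, Continuous fun ω => (f n ω).re := fun n =>
    Complex.continuous_re.comp (hcont n)
  have hzero : ∀ n, (f n 0).re = 1 := by
    intro n
    induction n using Nat.twoStepInduction with
    | zero => simp [hf0]
    | one => exact hx1 0
    | more n h0 h1 =>
      have h := hxrec 0 n
      have hane := (ha (n + 2) (by omega)).ne'
      rw [h0, h1] at h
      simp [hane] at h
      linarith
  have hpos : ∀ n (w : ℝ), (∀ t, 0 < t → t < w → 0 < (f n t).re) →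
      ∀ j ≤ n, ∀ t, 0 < t → t < w → 0 < (f j t).re := by
    intro n
    induction n with
    | zero =>
      intro w _ j hj t _ _
      simp [Nat.le_zero.1 hj, hf0]
    | succ n ih =>
      intro w hw
      suffices hn : ∀ t, 0 < t → t < w → 0 < (f n t).re by
        intro j hj
        rcases Nat.le_succ_iff.1 hj with hj | rfl
        · exact ih w hn j hj
        · exact hw
      rcases Nat.eq_zero_or_pos n with rfl | hn
      · simp [hf0]
      intro t ht htw
      by_contra! hcon
      obtain ⟨z, hz, hzt, hfz, hbefore⟩ :=
        exists_first_pos_zero (hcre n) (by simp [hzero]) ht hcon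
      have hlt := ((hmono z hz n fun j hj => nonneg_right_endpoint_of_pos (hcre j) hz
        (ih z hbefore j hj)).2.2.2.2 hn).1
      have := hw z hz (hzt.trans_lt htw)
      simp only [hfz] at hlt
      linarith
  have hn_pos : ∀ t, 0 < t → t < ω → 0 < (f n t).re := by
    intro t ht htω
    by_contra! hcon
    obtain ⟨z, hz, hzt, hfz, -⟩ :=
      exists_first_pos_zero (hcre n) (by simp [hzero]) ht hcon
    linarith [hωn z hz hfz]
  obtain ⟨m, rfl⟩ : ∃ m, n = m + 1 := ⟨n - 1, by omega⟩
  obtain ⟨him, -, -, -, hstrict⟩ := hmono ω hω m fun j hj =>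
    nonneg_right_endpoint_of_pos (hcre j) hω (hpos (m + 1) ω hn_pos j (by omega))
  have hne : f (m + 1) ω ≠ 0 := fun h => by simp [h] at him
  have hre := (hstrict (by omega)).2
  exact ⟨hne, hre, outside_debye_of_re_lt_one hne hre⟩
end

section
/- Let N ≥ 1, M ≥ 1, and let w : {0,…,N−1} × (ℤ/Mℤ) → ℝ, w(n,m) > 0, be jump rates of the two-dimensional random trap model on the cylinder. Suppose u : {0,…,N} × (ℤ/Mℤ) → ℝ satisfies: u(N,m) = 0 for all m; for 1 ≤ n ≤ N−1 and all m, w(n,m)·(u(n+1,m) + u(n−1,m) + u(n,m+1) + u(n,m−1) − 4u(n,m)) = −1; and at the reflecting end n = 0, w(0,m)·(u(1,m) + u(0,m+1) + u(0,m−1) − 3u(0,m)) = −1 for all m. Then (1/M) Σ_{m} u(0,m) = (1/M) Σ_{m} Σ_{n=0}^{N−1} (N−n)/w(n,m). In other words, the mean first-passage time of the two-dimensional random trap model, averaged uniformly over the starting sites on the illuminated end, equals the average over the transverse coordinate m of the one-dimensional trap-model MFPTs t₁^{(m)} = Σ_{n=0}^{N−1} (N−n)/w(n,m). -/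
/-- A finite sequence whose consecutive decrements are the partial sums of `R` satisfies
`S 0 = S k + Σ_{n<k} (k - n) R n`. -/
theorem eq_add_sum_range_mul_of_sub_eq_sum (S R : ℕ → ℝ) (k : ℕ)
    (h : ∀ j < k, S j - S (j + 1) = ∑ n ∈ Finset.range (j + 1), R n) :
    S 0 = S k + ∑ n ∈ Finset.range k, ((k - n : ℕ) : ℝ) * R n := by
  induction k with
  | zero => simp
  | succ k ih =>
    have hsum : ∑ n ∈ Finset.range (k + 1), ((k + 1 - n : ℕ) : ℝ) * R n =
        ∑ n ∈ Finset.range k, ((k - n : ℕ) : ℝ) * R n + ∑ n ∈ Finset.range (k + 1), R n := by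
      rw [Finset.sum_range_succ, Finset.sum_range_succ, ← add_assoc, ← Finset.sum_add_distrib]
      congr 1
      · refine Finset.sum_congr rfl fun n hn => ?_
        rw [Nat.sub_add_comm (Finset.mem_range.mp hn).le]
        push_cast
        ring
      · simp
    rw [hsum, ← h k k.lt_succ_self, ih fun j hj => h j (hj.trans k.lt_succ_self)]
    ring

/-- A sum over `ZMod M` is invariant under forward and backward unit shifts. -/
theorem ZMod.sum_add_one_and_sub_one {M : ℕ} [NeZero M] (f : ZMod M → ℝ) :
    ∑ m, f (m + 1) = ∑ m, f m ∧ ∑ m, f (m - 1) = ∑ m, f m :=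
  ⟨Equiv.sum_comp (Equiv.addRight 1) f, Equiv.sum_comp (Equiv.subRight 1) f⟩

/-- For the two-dimensional random trap model on the cylinder `{0,…,N} × (ℤ/Mℤ)` with
absorbing column `N` and reflecting column `0`, any solution `u` of the stationary
backward equations satisfies
`(1/M) Σ_m u(0,m) = (1/M) Σ_m Σ_{n=0}^{N−1} (N−n)/w(n,m)`:
the MFPT averaged over the illuminated end is the transverse average of the
one-dimensional trap-model MFPTs. -/
theorem stmt9 (N M : ℕ) (hN : 1 ≤ N) [NeZero M]
    (w : ℕ → ZMod M → ℝ) (hw : ∀ n, n ≤ N - 1 → ∀ m, 0 < w n m)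
    (u : ℕ → ZMod M → ℝ)
    (habs : ∀ m, u N m = 0)
    (hint : ∀ n, 1 ≤ n → n ≤ N - 1 → ∀ m,
      w n m * (u (n + 1) m + u (n - 1) m + u n (m + 1) + u n (m - 1) - 4 * u n m) = -1)
    (hrefl : ∀ m, w 0 m * (u 1 m + u 0 (m + 1) + u 0 (m - 1) - 3 * u 0 m) = -1) :
    (1 / (M : ℝ)) * ∑ m : ZMod M, u 0 m =
      (1 / (M : ℝ)) * ∑ m : ZMod M, ∑ n ∈ Finset.range N, ((N - n : ℕ) : ℝ) / w n m := by
  have hinv : ∀ n, n ≤ N - 1 → ∀ m x, w n m * x = -1 → x = -(w n m)⁻¹ := fun n hn m x hx => by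
    have := (hw n hn m).ne'
    field_simp
    linarith
  have hcol : ∀ j < N, ∑ m, u j m - ∑ m, u (j + 1) m =
      ∑ n ∈ Finset.range (j + 1), ∑ m, (w n m)⁻¹ := by
    intro j
    induction j with
    | zero =>
      intro _
      have hs := Finset.sum_congr rfl fun m (_ : m ∈ Finset.univ) =>
        hinv 0 (Nat.zero_le _) m _ (hrefl m)
      simp only [Finset.sum_sub_distrib, Finset.sum_add_distrib, ← Finset.mul_sum,
        Finset.sum_neg_distrib, ZMod.sum_add_one_and_sub_one (u 0)] at hs
      simp only [zero_add, Finset.sum_range_one]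
      linarith
    | succ j ih =>
      intro hj
      have hs := Finset.sum_congr rfl fun m (_ : m ∈ Finset.univ) =>
        hinv (j + 1) (by omega) m _ (hint (j + 1) (by omega) (by omega) m)
      simp only [Finset.sum_sub_distrib, Finset.sum_add_distrib, ← Finset.mul_sum,
        Finset.sum_neg_distrib, ZMod.sum_add_one_and_sub_one (u (j + 1)),
        Nat.add_sub_cancel] at hs
      rw [Finset.sum_range_succ, ← ih (by omega)]
      linarith
  have key := eq_add_sum_range_mul_of_sub_eq_sum (fun n => ∑ m, u n m)
    (fun n => ∑ m, (w n m)⁻¹) N hcol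
  simp only [habs, Finset.sum_const_zero, zero_add] at key
  rw [key, Finset.sum_comm]
  simp only [Finset.mul_sum, div_eq_mul_inv]
end
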